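/- Let A, B, C be in SL(3,ℂ) with CBA = I and suppose tr(A) = tr(A⁻¹), tr(B) = tr(B⁻¹), tr(C) = tr(C⁻¹), σ₊(A,B,C) = σ₋(A,B,C) and tr([A,B]) = tr([A,B]⁻¹). Then either the pair {A, B} is reducible (there exists a ℂ-linear subspace W of ℂ³ with W ≠ {0}, W ≠ ℂ³, A·W ⊆ W and B·W ⊆ W), or there exist an invertible 3×3 complex matrix D and Â, B̂ in SL(2,ℂ) such that DAD⁻¹ = Φ*(Â) and DBD⁻¹ = Φ*(B̂). -/

import Mathlib

open Matrix

/-- The irreducible representation of `SL(2,ℂ)` on `ℂ³` at the level of matrices. -/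
noncomputable def PhiStar (M : Matrix (Fin 2) (Fin 2) ℂ) : Matrix (Fin 3) (Fin 3) ℂ :=
  !![(M 0 0) ^ 2, -(Real.sqrt 2 : ℂ) * M 0 0 * M 0 1, -(M 0 1) ^ 2;
     -(Real.sqrt 2 : ℂ) * M 0 0 * M 1 0, M 0 0 * M 1 1 + M 0 1 * M 1 0,
       (Real.sqrt 2 : ℂ) * M 0 1 * M 1 1;
     -(M 1 0) ^ 2, (Real.sqrt 2 : ℂ) * M 1 0 * M 1 1, (M 1 1) ^ 2]

section CyclicPredicate

variable {G : Type*} [Group G]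

open Pointwise

/-- The products `a ^ m * b ^ n` with integer exponents. -/
def twoGenSyllables (a b : G) : Set G := {g | ∃ m n : ℤ, g = a ^ m * b ^ n}

/-- A predicate on a group with the closure properties of the set of `g` for which a
three-dimensional unimodular character agrees on `g` and `g⁻¹`. -/
structure IsCharacterLike (p : G → Prop) : Prop where
  one : p 1
  inv : ∀ g, p g → p g⁻¹
  cyc : ∀ x y, p (x * y) → p (y * x)
  step : ∀ x g, p g → p (x * g⁻¹) → p x → p (x * g) → p (x * g * g)

variable {p : G → Prop} {a b : G}

namespace IsCharacterLike

theorem mul_zpow (hp : IsCharacterLike p) {x g : G} (hg : p g) (h₁ : p (x * g⁻¹)) (h₀ : p x)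
    (h₂ : p (x * g)) (m : ℤ) : p (x * g ^ m) := by
  suffices H : ∀ m : ℤ, p (x * g ^ (m - 1)) ∧ p (x * g ^ m) ∧ p (x * g ^ (m + 1)) from (H m).2.1
  intro m
  induction m using Int.induction_on with
  | zero => simpa using ⟨h₁, h₀, h₂⟩
  | succ i ih =>
    obtain ⟨i₁, i₂, i₃⟩ := ih
    refine ⟨by simpa using i₂, i₃, ?_⟩
    have := hp.step (x * g ^ (i : ℤ)) g hg (by convert i₁ using 1; group) i₂
      (by convert i₃ using 1; group)
    convert this using 1; group
  | pred i ih =>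
    obtain ⟨i₁, i₂, i₃⟩ := ih
    refine ⟨?_, i₁, by simpa using i₂⟩
    have := hp.step (x * g ^ (-(i : ℤ))) g⁻¹ (hp.inv g hg) (by convert i₃ using 1; group) i₂
      (by convert i₁ using 1; group)
    convert this using 1; group

theorem zpow_mul_zpow (hp : IsCharacterLike p) (ha : p a) (hb : p b) {r : G}
    (ha₀ : ∀ m : ℤ, p (a ^ m * r)) (hb₀ : ∀ n : ℤ, p (b ^ n * r))
    (hu : ∀ ε δ : ℤ, (ε = 1 ∨ ε = -1) → (δ = 1 ∨ δ = -1) → p (a ^ ε * b ^ δ * r)) (m n : ℤ) :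
    p (a ^ m * b ^ n * r) := by
  have key : ∀ δ : ℤ, (δ = 1 ∨ δ = -1) → ∀ m : ℤ, p (b ^ δ * r * a ^ m) := fun δ hδ m ↦
    hp.mul_zpow ha
      (hp.cyc _ _ (by simpa [mul_assoc] using hu (-1) δ (by simp) hδ)) (hb₀ δ)
      (hp.cyc _ _ (by simpa [mul_assoc] using hu 1 δ (by simp) hδ)) m
  have := hp.mul_zpow (x := r * a ^ m) hb
    (hp.cyc _ _ (by simpa [mul_assoc] using key (-1) (by simp) m))
    (hp.cyc _ _ (ha₀ m))
    (hp.cyc _ _ (by simpa [mul_assoc] using key 1 (by simp) m)) n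
  have := hp.cyc r (a ^ m * b ^ n) (by simpa [mul_assoc] using this)
  exact this

end IsCharacterLike

theorem zpow_mul_mem_syllables_pow {j : ℕ} {r : G} (hr : r ∈ twoGenSyllables a b ^ (j + 1))
    (l : ℤ) : a ^ l * r ∈ twoGenSyllables a b ^ (j + 1) := by
  rw [pow_succ'] at hr ⊢
  obtain ⟨_, ⟨m, n, rfl⟩, s, hs, rfl⟩ := hr
  exact ⟨_, ⟨l + m, n, rfl⟩, s, hs, by simp only [_root_.zpow_add, mul_assoc]⟩

theorem mul_zpow_mem_syllables_pow {j : ℕ} {r : G} (hr : r ∈ twoGenSyllables a b ^ (j + 1))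
    (l : ℤ) : r * b ^ l ∈ twoGenSyllables a b ^ (j + 1) := by
  rw [pow_succ] at hr ⊢
  obtain ⟨s, hs, _, ⟨m, n, rfl⟩, rfl⟩ := hr
  exact ⟨s, hs, _, ⟨m, n + l, rfl⟩, by simp only [_root_.zpow_add, mul_assoc]⟩

theorem mul_mem_syllables_pow_succ {j : ℕ} {r : G} (hr : r ∈ twoGenSyllables a b ^ j)
    (m n : ℤ) : a ^ m * b ^ n * r ∈ twoGenSyllables a b ^ (j + 1) := by
  rw [pow_succ']
  exact ⟨_, ⟨m, n, rfl⟩, r, hr, rfl⟩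

theorem mem_syllables_pow_succ_mul {j : ℕ} {r : G} (hr : r ∈ twoGenSyllables a b ^ j)
    (m n : ℤ) : r * (a ^ m * b ^ n) ∈ twoGenSyllables a b ^ (j + 1) := by
  rw [pow_succ]
  exact ⟨r, hr, _, ⟨m, n, rfl⟩, rfl⟩

namespace IsCharacterLike

theorem of_same_fst (hp : IsCharacterLike p) {j : ℕ}
    (ih : ∀ w ∈ twoGenSyllables a b ^ (j + 1), p w) {r : G} (hr : r ∈ twoGenSyllables a b ^ j)
    {ε δ₁ δ₂ : ℤ} (hg : p (a ^ ε * b ^ δ₁)) :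
    p (a ^ ε * b ^ δ₁ * (a ^ ε * b ^ δ₂) * r) := by
  have h := hp.step (b ^ (δ₂ - δ₁) * r) (a ^ ε * b ^ δ₁) hg ?_ ?_ ?_
  · have := hp.cyc (b ^ (δ₂ - δ₁) * r) (a ^ ε * b ^ δ₁ * (a ^ ε * b ^ δ₁))
      (by simpa only [mul_assoc] using h)
    convert this using 1; group
  · have := ih _ (mul_zpow_mem_syllables_pow
      (mul_mem_syllables_pow_succ hr (-ε) (δ₂ - δ₁)) (-δ₁))
    have := hp.cyc (a ^ (-ε)) (b ^ (δ₂ - δ₁) * r * b ^ (-δ₁))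
      (by simpa only [mul_assoc] using this)
    convert this using 1; group
  · simpa using ih _ (mul_mem_syllables_pow_succ hr 0 (δ₂ - δ₁))
  · refine hp.cyc _ _ ?_
    convert ih _ (mul_mem_syllables_pow_succ hr ε δ₂) using 1; group

theorem of_same_snd (hp : IsCharacterLike p) {j : ℕ}
    (ih : ∀ w ∈ twoGenSyllables a b ^ (j + 1), p w) {r : G} (hr : r ∈ twoGenSyllables a b ^ j)
    {ε₁ ε₂ δ : ℤ} (hg : p (a ^ ε₂ * b ^ δ)) :
    p (a ^ ε₁ * b ^ δ * (a ^ ε₂ * b ^ δ) * r) := by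
  have h := hp.step (a ^ (-ε₂) * r * a ^ ε₁) (b ^ δ * a ^ ε₂) (hp.cyc _ _ hg) ?_ ?_ ?_
  · have := hp.cyc (a ^ (-ε₂) * r) (a ^ ε₁ * (b ^ δ * a ^ ε₂) * (b ^ δ * a ^ ε₂))
      (by simpa only [mul_assoc] using h)
    convert this using 1; group
  · have := ih _ (zpow_mul_mem_syllables_pow
      (mem_syllables_pow_succ_mul hr (ε₁ - ε₂) (-δ)) (-ε₂))
    convert this using 1; group
  · have := ih _ (mul_mem_syllables_pow_succ hr (ε₁ - ε₂) 0)
    have := hp.cyc (a ^ ε₁) (a ^ (-ε₂) * r) (by convert this using 1; group)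
    exact this
  · have := ih _ (mem_syllables_pow_succ_mul hr ε₁ δ)
    have := hp.cyc (a ^ ε₂) (a ^ (-ε₂) * r * a ^ ε₁ * b ^ δ) (by convert this using 1; group)
    convert this using 1; group

theorem commutator_signs (hp : IsCharacterLike p) (hK : p (a * b * a⁻¹ * b⁻¹)) {ε δ : ℤ}
    (hε : ε = 1 ∨ ε = -1) (hδ : δ = 1 ∨ δ = -1) :
    p (a ^ ε * b ^ δ * (a ^ (-ε) * b ^ (-δ))) := by
  have hK' := hp.inv _ hK
  rcases hε with rfl | rfl <;> rcases hδ with rfl | rfl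
  · convert hK using 1; group
  · have := hp.cyc b (a * b⁻¹ * a⁻¹) (by convert hK' using 1; group)
    convert this using 1; group
  · have := hp.cyc (b * a * b⁻¹) a⁻¹ (by convert hK' using 1; group)
    convert this using 1; group
  · have := hp.cyc (a * b) (a⁻¹ * b⁻¹) (by convert hK using 1; group)
    convert this using 1; group

theorem pair_signs (hp : IsCharacterLike p) (hab : p (b * a)) (hab' : p (a⁻¹ * b)) {ε δ : ℤ}
    (hε : ε = 1 ∨ ε = -1) (hδ : δ = 1 ∨ δ = -1) : p (a ^ ε * b ^ δ) := by
  rcases hε with rfl | rfl <;> rcases hδ with rfl | rfl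
  · simpa using hp.cyc _ _ hab
  · simpa using hp.inv _ (hp.cyc _ _ hab')
  · simpa using hab'
  · simpa using hp.inv _ hab

def signSyllables (a b : G) : Set G :=
  {g | ∃ ε δ : ℤ, (ε = 1 ∨ ε = -1) ∧ (δ = 1 ∨ δ = -1) ∧ g = a ^ ε * b ^ δ}

theorem signSyllables_subset : signSyllables a b ⊆ twoGenSyllables a b := by
  rintro _ ⟨ε, δ, -, -, rfl⟩
  exact ⟨ε, δ, rfl⟩

theorem of_mem_signSyllables_pow (hp : IsCharacterLike p)
    (hab : p (b * a)) (hab' : p (a⁻¹ * b)) (hK : p (a * b * a⁻¹ * b⁻¹)) {k : ℕ}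
    (ih : ∀ j < k + 2, ∀ w ∈ twoGenSyllables a b ^ j, p w) :
    ∀ w ∈ signSyllables a b ^ (k + 2), p w := by
  have sub : ∀ j, signSyllables a b ^ j ⊆ twoGenSyllables a b ^ j := fun j ↦
    Set.pow_subset_pow_left signSyllables_subset
  have pattern : ∀ ε₁ δ₁ ε₂ δ₂ : ℤ, (ε₁ = 1 ∨ ε₁ = -1) → (δ₁ = 1 ∨ δ₁ = -1) →
      (ε₂ = 1 ∨ ε₂ = -1) → (δ₂ = 1 ∨ δ₂ = -1) → ¬ (ε₂ = -ε₁ ∧ δ₂ = -δ₁) →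
      ∀ r ∈ twoGenSyllables a b ^ k, p (a ^ ε₁ * b ^ δ₁ * (a ^ ε₂ * b ^ δ₂) * r) := by
    intro ε₁ δ₁ ε₂ δ₂ h₁ h₂ h₃ h₄ hne r hr
    have : ε₂ = ε₁ ∨ δ₂ = δ₁ := by omega
    rcases this with rfl | rfl
    · exact hp.of_same_fst (ih (k + 1) (by omega)) hr (hp.pair_signs hab hab' h₃ h₂)
    · exact hp.of_same_snd (ih (k + 1) (by omega)) hr (hp.pair_signs hab hab' h₃ h₄)
  intro w hw
  rw [pow_succ', pow_succ'] at hw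
  obtain ⟨_, ⟨ε, δ, hε, hδ, rfl⟩, _, ⟨_, ⟨ε₂, δ₂, hε₂, hδ₂, rfl⟩, r, hr, rfl⟩, rfl⟩ := hw
  simp only
  rw [← mul_assoc]
  by_cases h₂ : ε₂ = -ε ∧ δ₂ = -δ
  swap
  · exact pattern _ _ _ _ hε hδ hε₂ hδ₂ h₂ r (sub _ hr)
  obtain ⟨rfl, rfl⟩ := h₂
  have hKs := hp.commutator_signs hK hε hδ
  match k with
  | 0 =>
    obtain rfl : r = 1 := by simpa using hr
    simpa using hKs
  | k + 1 =>
    rw [pow_succ'] at hr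
    obtain ⟨_, ⟨ε₃, δ₃, hε₃, hδ₃, rfl⟩, s, hs, rfl⟩ := hr
    simp only
    by_cases h₃ : ε₃ = - -ε ∧ δ₃ = - -δ
    swap
    · have := pattern _ _ _ _ hε₂ hδ₂ hε₃ hδ₃ h₃ _ (mem_syllables_pow_succ_mul (sub _ hs) ε δ)
      have := hp.cyc (a ^ (-ε) * b ^ (-δ) * (a ^ ε₃ * b ^ δ₃) * s) (a ^ ε * b ^ δ)
        (by simpa only [mul_assoc] using this)
      simpa only [mul_assoc] using this
    obtain ⟨rfl, rfl⟩ := h₃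
    simp only [neg_neg]
    match k with
    | 0 =>
      obtain rfl : s = 1 := by simpa using hs
      have hmem : a ^ (-ε) * b ^ (-δ) ∈ twoGenSyllables a b ^ (0 + 1) := by
        rw [zero_add, pow_one]
        exact ⟨_, _, rfl⟩
      have := pattern ε δ ε δ hε hδ hε hδ (by omega) _ hmem
      have := hp.cyc (a ^ ε * b ^ δ) (a ^ ε * b ^ δ * (a ^ (-ε) * b ^ (-δ)))
        (by simpa only [mul_assoc] using this)
      simpa only [mul_assoc, mul_one] using this
    | k + 1 =>
      rw [pow_succ'] at hs
      obtain ⟨_, ⟨ε₄, δ₄, hε₄, hδ₄, rfl⟩, s, hs, rfl⟩ := hs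
      simp only
      have hs' := sub _ hs
      have hsK : s * (a ^ ε * b ^ δ) * (a ^ (-ε) * b ^ (-δ)) ∈ twoGenSyllables a b ^ (k + 1 + 1) :=
        mem_syllables_pow_succ_mul (mem_syllables_pow_succ_mul hs' _ _) _ _
      by_cases h₄ : ε₄ = -ε ∧ δ₄ = -δ
      swap
      · have := pattern _ _ _ _ hε hδ hε₄ hδ₄ h₄ _ hsK
        have := hp.cyc (a ^ ε * b ^ δ * (a ^ ε₄ * b ^ δ₄) * s)
          (a ^ ε * b ^ δ * (a ^ (-ε) * b ^ (-δ))) (by simpa only [mul_assoc] using this)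
        simpa only [mul_assoc] using this
      obtain ⟨rfl, rfl⟩ := h₄
      have := hp.step s _ hKs ?_ (ih k (by omega) s hs') ?_
      · have := hp.cyc s ((a ^ ε * b ^ δ * (a ^ (-ε) * b ^ (-δ))) *
          (a ^ ε * b ^ δ * (a ^ (-ε) * b ^ (-δ)))) (by simpa only [mul_assoc] using this)
        simpa only [mul_assoc] using this
      · have := ih _ (by omega) _ (zpow_mul_mem_syllables_pow (mem_syllables_pow_succ_mul
          (mem_syllables_pow_succ_mul hs' 0 δ) ε (-δ)) (-ε))
        have := hp.cyc _ _ this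
        convert this using 1; group
      · have := ih _ (by omega) _ hsK
        simpa only [mul_assoc] using this

theorem of_mem_twoGenSyllables_pow (hp : IsCharacterLike p) (ha : p a) (hb : p b)
    (hab : p (b * a)) (hab' : p (a⁻¹ * b)) (hK : p (a * b * a⁻¹ * b⁻¹)) (k : ℕ) :
    ∀ w ∈ twoGenSyllables a b ^ k, p w := by
  induction k using Nat.strong_induction_on with
  | _ k ih =>
  have hpow : ∀ g, p g → ∀ m : ℤ, p (g ^ m) := fun g hg m ↦ by
    simpa using hp.mul_zpow (x := 1) hg (by simpa using hp.inv g hg) hp.one (by simpa using hg) m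
  match k with
  | 0 => simpa using hp.one
  | 1 =>
    rw [pow_one]
    rintro _ ⟨m, n, rfl⟩
    have := hp.zpow_mul_zpow ha hb (r := 1) (by simpa using hpow a ha) (by simpa using hpow b hb)
      (fun ε δ hε hδ ↦ by simpa using hp.pair_signs hab hab' hε hδ) m n
    simpa using this
  | k + 2 =>
    have main : ∀ i j : ℕ, i + j = k + 2 →
        ∀ w ∈ twoGenSyllables a b ^ i * signSyllables a b ^ j, p w := by
      intro i
      induction i with
      | zero =>
        intro j hj w hw
        obtain rfl : j = k + 2 := by omega
        exact hp.of_mem_signSyllables_pow hab hab' hK ih w (by simpa using hw)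
      | succ i hi =>
        intro j hj w hw
        rw [pow_succ', mul_assoc] at hw
        obtain ⟨_, ⟨m, n, rfl⟩, r, hr, rfl⟩ := hw
        have hr' : r ∈ twoGenSyllables a b ^ (k + 1) := by
          rw [show k + 1 = i + j by omega, pow_add]
          exact Set.mul_subset_mul_left (Set.pow_subset_pow_left signSyllables_subset) hr
        refine hp.zpow_mul_zpow ha hb ?_ ?_ ?_ m n
        · exact fun m ↦ ih _ (by omega) _ (zpow_mul_mem_syllables_pow hr' m)
        · exact fun n ↦ hp.cyc _ _ (ih _ (by omega) _ (mul_zpow_mem_syllables_pow hr' n))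
        · intro ε δ hε hδ
          refine hp.cyc _ _ (hi (j + 1) (by omega) _ ?_)
          rw [pow_succ, ← mul_assoc]
          exact ⟨r, hr, _, ⟨ε, δ, hε, hδ, rfl⟩, rfl⟩
    simpa using main (k + 2) 0 rfl

theorem of_mem_closure (hp : IsCharacterLike p) (ha : p a) (hb : p b)
    (hab : p (b * a)) (hab' : p (a⁻¹ * b)) (hK : p (a * b * a⁻¹ * b⁻¹)) {w : G}
    (hw : w ∈ Subgroup.closure {a, b}) : p w := by
  suffices H : ∃ k, w ∈ twoGenSyllables a b ^ k by
    obtain ⟨k, hk⟩ := H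
    exact hp.of_mem_twoGenSyllables_pow ha hb hab hab' hK k w hk
  induction hw using Subgroup.closure_induction_left with
  | one => exact ⟨0, by simp⟩
  | mul_left x hx y _ ih =>
    obtain ⟨k, hk⟩ := ih
    rcases hx with rfl | rfl
    · exact ⟨k + 1, by simpa using mul_mem_syllables_pow_succ hk 1 0⟩
    · exact ⟨k + 1, by simpa using mul_mem_syllables_pow_succ hk 0 1⟩
  | inv_mul_cancel x hx y _ ih =>
    obtain ⟨k, hk⟩ := ih
    rcases hx with rfl | rfl
    · exact ⟨k + 1, by simpa using mul_mem_syllables_pow_succ hk (-1) 0⟩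
    · exact ⟨k + 1, by simpa using mul_mem_syllables_pow_succ hk 0 (-1)⟩

end IsCharacterLike

end CyclicPredicate
section TraceForm

local notation "M₃" => Matrix (Fin 3) (Fin 3) ℂ
local notation "SL₃" => Matrix.SpecialLinearGroup (Fin 3) ℂ

theorem sq_fin_three {R : Type*} [CommRing R] (M : Matrix (Fin 3) (Fin 3) R) :
    M * M = M.trace • M - M.adjugate.trace • (1 : Matrix (Fin 3) (Fin 3) R) + M.adjugate := by
  ext i j
  fin_cases i <;> fin_cases j <;>
    simp [Matrix.mul_apply, Fin.sum_univ_three, trace_fin_three, adjugate_fin_three] <;> ring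

theorem isCharacterLike_trace_eq_trace_inv :
    IsCharacterLike fun g : SL₃ ↦
      (g : M₃).trace = ((g⁻¹ : SL₃) : M₃).trace where
  one := by simp
  inv g h := by simpa using h.symm
  cyc x y h := by
    rw [_root_.mul_inv_rev] at h ⊢
    simp only [Matrix.SpecialLinearGroup.coe_mul] at h ⊢
    rw [trace_mul_comm, h, trace_mul_comm]
  step x g hg h₁ h₀ h₂ := by
    have e₁ : (g * g : M₃)
        = (g : M₃).trace • (g : M₃)
          - (g : M₃).trace • (1 : M₃)
          + (g⁻¹ : SL₃) := by
      conv_rhs => enter [1, 2]; rw [hg]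
      exact sq_fin_three _
    have e₂ : ((g⁻¹ : SL₃) * (g⁻¹ : SL₃) :
          M₃)
        = (g : M₃).trace • ((g⁻¹ : SL₃) : M₃)
          - (g : M₃).trace • (1 : M₃) + g := by
      have := sq_fin_three ((g⁻¹ : SL₃) : M₃)
      rwa [← Matrix.SpecialLinearGroup.coe_inv, inv_inv, ← hg] at this
    simp only [_root_.mul_inv_rev, inv_inv, Matrix.SpecialLinearGroup.coe_mul] at h₁ h₀ h₂ ⊢
    rw [← mul_assoc, mul_assoc (x : M₃), e₁, e₂]
    simp only [mul_add, mul_sub, add_mul, sub_mul, trace_add, trace_sub,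
      Matrix.mul_smul, Matrix.smul_mul, trace_smul, mul_one, one_mul, smul_eq_mul]
    linear_combination (g : M₃).trace * h₂ - (g : M₃).trace * h₀ + h₁

theorem exists_eq_vecMulVec_of_adjugate_eq_zero {M : M₃}
    (hM : M.adjugate = 0) : ∃ v f : Fin 3 → ℂ, M = vecMulVec v f := by
  by_cases h0 : M = 0
  · exact ⟨0, 0, by simp [h0]⟩
  obtain ⟨i, j, hij⟩ : ∃ i j, M i j ≠ 0 := by
    by_contra! h
    exact h0 (Matrix.ext h)
  refine ⟨fun k ↦ M k j, fun l ↦ M i l / M i j, ?_⟩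
  ext k l
  rw [vecMulVec_apply, mul_div_assoc', eq_div_iff hij]
  rw [adjugate_fin_three] at hM
  have h := fun r s ↦ congrFun (congrFun hM r) s
  simp only [Fin.forall_fin_succ, Fin.isValue] at h
  simp at h
  clear hij hM h0
  fin_cases i <;> fin_cases j <;> fin_cases k <;> fin_cases l <;> simp <;> grind

variable {H : Subgroup SL₃}

theorem exists_invariant_symmetric_of_trace_eq_trace_inv
    (hirr : ∀ W : Submodule ℂ (Fin 3 → ℂ), (∀ g ∈ H, ∀ x ∈ W, (g : M₃) *ᵥ x ∈ W) → W = ⊥ ∨ W = ⊤)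
    (htr : ∀ g ∈ H, (g : M₃).trace = ((g⁻¹ : SL₃) : M₃).trace) {c : SL₃} (hc : c ∈ H)
    {τ : ℂ} {v f : Fin 3 → ℂ} (hv : v ≠ 0) (hf : f ≠ 0)
    (hE : (c : M₃) + ((c⁻¹ : SL₃) : M₃) - τ • (1 : M₃) = vecMulVec v f) :
    ∃ S : M₃, S.det ≠ 0 ∧ Sᵀ = S ∧ ∀ g ∈ H, g.1ᵀ * S * (g : M₃) = S := by
  have hmul : ∀ g : SL₃, (g : M₃) * ((g⁻¹ : SL₃) : M₃) = 1 := fun g ↦ by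
    rw [← Matrix.SpecialLinearGroup.coe_mul]; simp
  have hmul' : ∀ g : SL₃, ((g⁻¹ : SL₃) : M₃) * (g : M₃) = 1 := fun g ↦ by
    rw [← Matrix.SpecialLinearGroup.coe_mul]; simp
  have hcoef : ∀ g ∈ H, f ⬝ᵥ ((g : M₃) *ᵥ v) = (f ᵥ* ((g⁻¹ : SL₃) : M₃)) ⬝ᵥ v := by
    intro g hg
    have tr : ∀ g : SL₃, f ⬝ᵥ ((g : M₃) *ᵥ v)
        = ((c * g : SL₃) : M₃).trace + ((c⁻¹ * g : SL₃) : M₃).trace - τ * (g : M₃).trace := fun g ↦ by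
      have : (vecMulVec v f * (g : M₃)).trace = f ⬝ᵥ ((g : M₃) *ᵥ v) := by
        rw [vecMulVec_mul, trace_vecMulVec, dotProduct_comm, dotProduct_mulVec]
      rw [← this, ← hE]
      simp [add_mul, sub_mul]
    rw [← dotProduct_mulVec, tr, tr]
    have h₁ := htr _ (H.mul_mem hc hg)
    have h₂ := htr _ (H.mul_mem (H.inv_mem hc) hg)
    have h₃ := htr _ hg
    rw [_root_.mul_inv_rev, Matrix.SpecialLinearGroup.coe_mul, Matrix.SpecialLinearGroup.coe_mul,
      trace_mul_comm ((g⁻¹ : SL₃) : M₃)] at h₁ h₂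
    rw [inv_inv] at h₂
    simp only [Matrix.SpecialLinearGroup.coe_mul]
    linear_combination h₁ + h₂ - τ * h₃
  let N : Submodule ℂ ((Fin 3 → ℂ) × (Fin 3 → ℂ)) :=
    Submodule.span ℂ {z | ∃ g ∈ H, z = ((g : M₃) *ᵥ v, f ᵥ* ((g⁻¹ : SL₃) : M₃))}
  have hN : ∀ g ∈ H, ∀ x y, (x, y) ∈ N → ((g : M₃) *ᵥ x, y ᵥ* ((g⁻¹ : SL₃) : M₃)) ∈ N := by
    intro g hg x y hxy
    let L : ((Fin 3 → ℂ) × (Fin 3 → ℂ)) →ₗ[ℂ] ((Fin 3 → ℂ) × (Fin 3 → ℂ)) :=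
      LinearMap.prodMap (g : M₃).mulVecLin ((g⁻¹ : SL₃) : M₃).vecMulLinear
    have : N ≤ N.comap L := by
      refine Submodule.span_le.2 ?_
      rintro _ ⟨w, hw, rfl⟩
      refine Submodule.subset_span ⟨g * w, H.mul_mem hg hw, ?_⟩
      simp [L, _root_.mul_inv_rev]
    exact this hxy
  have hpair : ∀ x y, (x, y) ∈ N → f ⬝ᵥ x = y ⬝ᵥ v := by
    intro x y hxy
    suffices H : ∀ z ∈ N, f ⬝ᵥ z.1 = z.2 ⬝ᵥ v from H _ hxy
    intro z hz
    induction hz using Submodule.span_induction with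
    | mem z hz =>
      obtain ⟨g, hg, rfl⟩ := hz
      exact hcoef g hg
    | zero => simp
    | add z w _ _ hz hw => simp [dotProduct_add, add_dotProduct, hz, hw]
    | smul t z _ hz => simp [hz]
  have hvN : (v, f) ∈ N := Submodule.subset_span ⟨1, H.one_mem, by simp⟩
  have hleft : ∀ x, (x, 0) ∈ N → x = 0 := by
    rcases hirr (N.comap (LinearMap.inl ℂ _ _))
      (fun g hg x hx ↦ by simpa using hN g hg x 0 (by simpa using hx)) with h | h
    · intro x hx
      have : x ∈ N.comap (LinearMap.inl ℂ _ _) := by simpa using hx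
      simpa [h] using this
    · refine absurd (dotProduct_eq_zero f fun x ↦ ?_) hf
      have : x ∈ N.comap (LinearMap.inl ℂ _ _) := by simp [h]
      simpa using hpair x 0 (by simpa using this)
  have hright : ∀ y, (0, y) ∈ N → y = 0 := by
    let W : Submodule ℂ (Fin 3 → ℂ) :=
      { carrier := {x | ∀ y, (0, y) ∈ N → y ⬝ᵥ x = 0}
        add_mem' := fun hx hx' y hy ↦ by rw [dotProduct_add, hx y hy, hx' y hy, add_zero]
        zero_mem' := fun y _ ↦ dotProduct_zero y
        smul_mem' := fun t x hx y hy ↦ by rw [dotProduct_smul, hx y hy, smul_zero] }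
    have hvW : v ∈ W := fun y hy ↦ by simpa using (hpair 0 y hy).symm
    rcases hirr W (fun g hg x hx y hy ↦ by
      rw [dotProduct_mulVec]
      exact hx _ (by simpa using hN g⁻¹ (H.inv_mem hg) 0 y hy)) with h | h
    · rw [h] at hvW
      exact absurd (by simpa using hvW) hv
    · intro y hy
      refine dotProduct_eq_zero y fun x ↦ ?_
      have : x ∈ W := by simp [h]
      exact this y hy
  have hsurj : ∀ x, ∃ y, (x, y) ∈ N := by
    rcases hirr (N.map (LinearMap.fst ℂ _ _)) (by
      rintro g hg _ ⟨⟨x, y⟩, hxy, rfl⟩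
      exact ⟨_, hN g hg x y hxy, rfl⟩) with h | h
    · have : v ∈ N.map (LinearMap.fst ℂ _ _) := ⟨_, hvN, rfl⟩
      rw [h] at this
      exact absurd (by simpa using this) hv
    · intro x
      have : x ∈ N.map (LinearMap.fst ℂ _ _) := by simp [h]
      obtain ⟨⟨x', y⟩, hxy, rfl⟩ := this
      exact ⟨y, hxy⟩
  choose y hy using fun i : Fin 3 ↦ hsurj (Pi.single i 1)
  let S : M₃ := (Matrix.of y)ᵀ
  have hS : ∀ x, (x, S *ᵥ x) ∈ N := by
    intro x
    have : (x, S *ᵥ x) = ∑ i, x i • ((Pi.single i 1, y i) : (Fin 3 → ℂ) × (Fin 3 → ℂ)) := by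
      refine Prod.ext ?_ ?_
      · rw [Prod.fst_sum]
        ext k
        simp [Pi.single_apply]
      · rw [Prod.snd_sum]
        ext k
        simp [S, mulVec, dotProduct, mul_comm]
    rw [this]
    exact N.sum_mem fun i _ ↦ N.smul_mem _ (hy i)
  have hinv : ∀ g ∈ H, g.1ᵀ * S * (g : M₃) = S := by
    intro g hg
    have key : S * (g : M₃) = ((g⁻¹ : SL₃) : M₃)ᵀ * S := by
      refine Matrix.ext_of_mulVec_single fun i ↦ ?_
      set x : Fin 3 → ℂ := Pi.single i 1
      have h := N.sub_mem (hS ((g : M₃) *ᵥ x)) (hN g hg _ _ (hS x))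
      rw [Prod.mk_sub_mk, sub_self] at h
      have := sub_eq_zero.1 (hright _ h)
      rw [← mulVec_mulVec, this, ← mulVec_mulVec, mulVec_transpose ((g⁻¹ : SL₃) : M₃)]
    rw [mul_assoc, key, ← mul_assoc, ← transpose_mul, hmul', transpose_one, one_mul]
  have hdet : S.det ≠ 0 := by
    intro h
    obtain ⟨x, hx, hSx⟩ := exists_mulVec_eq_zero_iff.2 h
    have := hS x
    rw [hSx] at this
    exact hx (hleft x this)
  refine ⟨S, hdet, ?_, hinv⟩
  have hskew : (Sᵀ - S).det = 0 := by
    simp [det_fin_three]; ring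
  obtain ⟨x, hx, hSx⟩ := exists_mulVec_eq_zero_iff.2 hskew
  rcases hirr (LinearMap.ker (Sᵀ - S).mulVecLin) (by
    intro g hg z hz
    rw [LinearMap.mem_ker, mulVecLin_apply] at hz ⊢
    have e : g.1ᵀ * (Sᵀ - S) * (g : M₃) = Sᵀ - S := by
      conv_rhs => rw [← hinv g hg]
      simp [mul_sub, sub_mul, mul_assoc]
    calc (Sᵀ - S) *ᵥ ((g : M₃) *ᵥ z)
        = (((g⁻¹ : SL₃) : M₃)ᵀ * (g.1ᵀ * (Sᵀ - S) * (g : M₃))) *ᵥ z := by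
          rw [mul_assoc g.1ᵀ, ← mul_assoc, ← transpose_mul, hmul, transpose_one, one_mul,
            mulVec_mulVec]
      _ = 0 := by rw [e, ← mulVec_mulVec, hz, mulVec_zero]) with h | h
  · have : x ∈ LinearMap.ker (Sᵀ - S).mulVecLin := LinearMap.mem_ker.2 hSx
    rw [h] at this
    exact absurd (by simpa using this) hx
  · refine sub_eq_zero.1 (Matrix.ext_of_mulVec_single fun i ↦ ?_)
    have : Pi.single i 1 ∈ LinearMap.ker (Sᵀ - S).mulVecLin := by rw [h]; trivial
    rw [zero_mulVec]
    exact this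

end TraceForm
section Congruence

theorem exists_transpose_mul_mul_eq {n : Type*} [Fintype n] [DecidableEq n]
    {S T : Matrix n n ℂ} (hS : Sᵀ = S) (hT : Tᵀ = T) (hS' : S.det ≠ 0) (hT' : T.det ≠ 0) :
    ∃ D : Matrix n n ℂ, Dᵀ * T * D = S := by
  have hassoc : ∀ {M : Matrix n n ℂ}, Mᵀ = M →
      QuadraticMap.associated (R := ℂ)
          (LinearMap.BilinMap.toQuadraticMap (toLinearMap₂' ℂ M : (n → ℂ) →ₗ[ℂ] (n → ℂ) →ₗ[ℂ] ℂ))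
        = Matrix.toLinearMap₂' ℂ M := by
    intro M hM
    refine QuadraticMap.associated_left_inverse ℂ fun x y ↦ ?_
    rw [toLinearMap₂'_apply', toLinearMap₂'_apply', dotProduct_mulVec, ← mulVec_transpose, hM,
      dotProduct_comm]
  obtain ⟨e⟩ := QuadraticForm.equivalent_of_isAlgClosed
    (LinearMap.BilinMap.toQuadraticMap (toLinearMap₂' ℂ S : (n → ℂ) →ₗ[ℂ] (n → ℂ) →ₗ[ℂ] ℂ))
    (LinearMap.BilinMap.toQuadraticMap (toLinearMap₂' ℂ T : (n → ℂ) →ₗ[ℂ] (n → ℂ) →ₗ[ℂ] ℂ))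
    (by rw [hassoc hS]; exact LinearMap.separatingLeft_toLinearMap₂'_of_det_ne_zero' hS')
    (by rw [hassoc hT]; exact LinearMap.separatingLeft_toLinearMap₂'_of_det_ne_zero' hT')
  set D := LinearMap.toMatrix' (e.toLinearEquiv : (n → ℂ) →ₗ[ℂ] (n → ℂ)) with hD
  have hDe : ∀ x, D *ᵥ x = e x := fun x ↦ by
    rw [hD, LinearMap.toMatrix'_mulVec]; rfl
  refine ⟨D, (Matrix.toLinearMap₂' ℂ (S₁ := ℂ) (S₂ := ℂ)).injective ?_⟩
  have hsymm : (Dᵀ * T * D)ᵀ = Dᵀ * T * D := by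
    simp [transpose_mul, hT, mul_assoc]
  rw [← hassoc hsymm, ← hassoc hS]
  congr 1
  ext x
  have := e.map_app x
  rw [LinearMap.BilinMap.toQuadraticMap_apply, LinearMap.BilinMap.toQuadraticMap_apply] at this ⊢
  rw [← this]
  change toLinearMap₂' ℂ _ _ _ = toLinearMap₂' ℂ T (e x) (e x)
  rw [← hDe, toLinearMap₂'_apply', toLinearMap₂'_apply', ← mulVec_mulVec, ← mulVec_mulVec,
    dotProduct_mulVec, vecMul_transpose]

end Congruence

section Orthogonal

/-- The symmetric form on `ℂ³` preserved by the image of `PhiStar`. -/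
def phiStarForm : Matrix (Fin 3) (Fin 3) ℂ := !![0, 0, 1; 0, 1, 0; 1, 0, 0]

theorem exists_eq_phiStar {M : Matrix (Fin 3) (Fin 3) ℂ} (hdet : M.det = 1)
    (hM : Mᵀ * phiStarForm * M = phiStarForm) :
    ∃ N : Matrix (Fin 2) (Fin 2) ℂ, N.det = 1 ∧ M = PhiStar N := by
  have hJJ : phiStarForm * phiStarForm = 1 := by
    ext i j; fin_cases i <;> fin_cases j <;> simp [phiStarForm, Matrix.mul_apply, Fin.sum_univ_three]
  have hadj : M.adjugate = phiStarForm * Mᵀ * phiStarForm := by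
    have h1 : (phiStarForm * Mᵀ * phiStarForm) * M = 1 := by
      rw [mul_assoc, mul_assoc, ← mul_assoc Mᵀ, hM, hJJ]
    have h2 : M * M.adjugate = 1 := by rw [mul_adjugate, hdet, one_smul]
    exact (left_inv_eq_right_inv h1 h2).symm
  have hM' : M * phiStarForm * Mᵀ = phiStarForm := by
    have : M * (phiStarForm * Mᵀ * phiStarForm) = 1 := by
      rw [← hadj, mul_adjugate, hdet, one_smul]
    calc M * phiStarForm * Mᵀ = M * (phiStarForm * Mᵀ * phiStarForm) * phiStarForm := by
          simp only [mul_assoc, hJJ, mul_one]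
      _ = phiStarForm := by rw [this, one_mul]
  have ea := fun i j ↦ congrFun (congrFun hadj i) j
  have eC := fun i j ↦ congrFun (congrFun hM i) j
  have eR := fun i j ↦ congrFun (congrFun hM' i) j
  rw [adjugate_fin_three] at ea
  simp only [Fin.forall_fin_succ, Fin.isValue] at ea eC eR
  simp [phiStarForm, Matrix.mul_apply, Fin.sum_univ_three] at eC eR
  simp [phiStarForm, Matrix.mul_apply, Fin.sum_univ_three, vecMul, dotProduct] at ea
  have hs : (Real.sqrt 2 : ℂ) ^ 2 = 2 := by
    rw [← Complex.ofReal_pow, Real.sq_sqrt (by norm_num)]; norm_num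
  generalize hsd : (Real.sqrt 2 : ℂ) = s at hs
  have hs0 : s ≠ 0 := by rintro rfl; norm_num at hs
  obtain ⟨⟨e1, -, e2⟩, -, e3, -, -⟩ := eC
  obtain ⟨⟨e4, -, -⟩, -, e5, -, e6⟩ := eR
  obtain ⟨⟨-, f1, f2⟩, ⟨-, -, f3⟩, -, f4, f5⟩ := ea
  suffices H : ∃ a b c d : ℂ, a * d - b * c = 1 ∧ M 0 0 = a ^ 2 ∧ M 0 1 = -s * a * b ∧
      M 0 2 = -b ^ 2 ∧ M 1 0 = -s * a * c ∧ M 1 1 = a * d + b * c ∧ M 1 2 = s * b * d ∧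
      M 2 0 = -c ^ 2 ∧ M 2 1 = s * c * d ∧ M 2 2 = d ^ 2 by
    obtain ⟨a, b, c, d, h, h1, h2, h3, h4, h5, h6, h7, h8, h9⟩ := H
    refine ⟨!![a, b; c, d], by rw [det_fin_two_of, h], ?_⟩
    ext i j
    fin_cases i <;> fin_cases j <;> simp [PhiStar, *]
  obtain ⟨a, ha⟩ := IsAlgClosed.exists_pow_nat_eq (M 0 0) two_pos
  by_cases ha0 : a = 0
  · have h00 : M 0 0 = 0 := by rw [← ha, ha0]; ring
    have h10 : M 1 0 = 0 := by rw [h00] at e1; simpa using e1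
    have h01 : M 0 1 = 0 := by rw [h00] at e4; simpa using e4
    simp only [h00, h10, h01, zero_mul, mul_zero, add_zero, zero_add, neg_zero, zero_sub]
      at e2 e3 e6 f1 f2
    obtain ⟨c, hc⟩ := IsAlgClosed.exists_pow_nat_eq (-M 2 0) two_pos
    have h20 : M 2 0 = -c ^ 2 := by rw [hc, neg_neg]
    have hc0 : c ≠ 0 := by rintro rfl; simp [h20] at e2
    have h02 : M 0 2 = -(-c⁻¹) ^ 2 := by
      field_simp; rw [h20] at e2; linear_combination -e2
    refine ⟨0, -c⁻¹, c, M 2 1 / (s * c), ?_, by simp [h00], by simp [h01], h02, by simp [h10], ?_, ?_,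
      h20, ?_, ?_⟩
    · field_simp; ring
    · have h02' : M 0 2 ≠ 0 := by rw [h02]; simp [hc0]
      rw [zero_mul, zero_add, neg_mul, inv_mul_cancel₀ hc0]
      refine mul_left_cancel₀ h02' ?_
      linear_combination -f2
    · rw [← f1, h02]; field_simp
    · field_simp
    · rw [h20] at e6
      field_simp
      linear_combination (-1 : ℂ) * e6 + M 2 2 * c ^ 2 * hs
  · obtain ⟨b, hb⟩ : ∃ b, M 0 1 = -s * a * b := ⟨-M 0 1 / (s * a), by field_simp⟩
    obtain ⟨c, hc⟩ : ∃ c, M 1 0 = -s * a * c := ⟨-M 1 0 / (s * a), by field_simp⟩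
    obtain ⟨d, hd⟩ : ∃ d, a * d - b * c = 1 := ⟨(1 + b * c) / a, by field_simp; ring⟩
    have h2a : a ^ 2 ≠ 0 := pow_ne_zero 2 ha0
    rw [hb, ← ha] at e4
    rw [hc, ← ha] at e1
    have h02 : M 0 2 = -b ^ 2 := by
      refine mul_left_cancel₀ h2a ?_
      linear_combination e4 / 2 - a ^ 2 * b ^ 2 / 2 * hs
    have h20 : M 2 0 = -c ^ 2 := by
      refine mul_left_cancel₀ h2a ?_
      linear_combination e1 / 2 - a ^ 2 * c ^ 2 / 2 * hs
    rw [hb, hc, ← ha] at f5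
    rw [hb, hc, ← ha, h02] at f3
    rw [hb, hc, ← ha, h20] at f4
    have h11 : M 1 1 = a * d + b * c := by
      refine mul_left_cancel₀ h2a ?_
      linear_combination f5 + a ^ 2 * b * c * hs - a ^ 2 * hd
    have h12 : M 1 2 = s * b * d := by
      refine mul_left_cancel₀ h2a ?_
      linear_combination -f3 - s * a * b * hd
    have h21 : M 2 1 = s * c * d := by
      refine mul_left_cancel₀ h2a ?_
      linear_combination -f4 - s * a * c * hd
    have h22 : M 2 2 = d ^ 2 := by
      refine mul_left_cancel₀ h2a ?_
      rw [hc, ← ha, h02, h20, h12] at e3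
      linear_combination e3 + a * b * c * d * hs - (a * d - b * c + 1) * hd
    exact ⟨a, b, c, d, hd, ha.symm, hb, h02, hc, h11, h12, h20, h21, h22⟩

end Orthogonal

section Unipotent

theorem adjugate_sub_one_fin_three {R : Type*} [CommRing R] (M : Matrix (Fin 3) (Fin 3) R) :
    (M - 1).adjugate = M + M.adjugate - (M.trace - 1) • (1 : Matrix (Fin 3) (Fin 3) R) := by
  ext i j
  fin_cases i <;> fin_cases j <;>
    simp [trace_fin_three, adjugate_fin_three] <;> ring

theorem det_sub_one_fin_three {R : Type*} [CommRing R] (M : Matrix (Fin 3) (Fin 3) R) :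
    (M - 1).det = M.det - M.adjugate.trace + M.trace - 1 := by
  simp [trace_fin_three, adjugate_fin_three, det_fin_three]
  ring

theorem exists_adjugate_sub_one_eq_vecMulVec {M : Matrix (Fin 3) (Fin 3) ℂ} (hdet : M.det = 1)
    (htr : M.trace = M.adjugate.trace) :
    ∃ v f : Fin 3 → ℂ, (M - 1).adjugate = vecMulVec v f := by
  refine exists_eq_vecMulVec_of_adjugate_eq_zero ?_
  rw [adjugate_adjugate _ (by simp), det_sub_one_fin_three, hdet, htr]
  simp

theorem exists_common_fixed_vector {M N : Matrix (Fin 3) (Fin 3) ℂ}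
    (hM : (M - 1).adjugate = 0) (hN : (N - 1).adjugate = 0) :
    ∃ x : Fin 3 → ℂ, x ≠ 0 ∧ M *ᵥ x = x ∧ N *ᵥ x = x := by
  obtain ⟨u, f, hu⟩ := exists_eq_vecMulVec_of_adjugate_eq_zero hM
  obtain ⟨v, g, hv⟩ := exists_eq_vecMulVec_of_adjugate_eq_zero hN
  have hdet : (Matrix.of ![f, g, 0]).det = 0 := det_eq_zero_of_row_eq_zero 2 fun j ↦ by simp
  obtain ⟨x, hx, h⟩ := exists_mulVec_eq_zero_iff.mpr hdet
  have hf : f ⬝ᵥ x = 0 := congrFun h 0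
  have hg : g ⬝ᵥ x = 0 := congrFun h 1
  refine ⟨x, hx, ?_, ?_⟩
  · rw [← sub_add_cancel M 1, hu, add_mulVec, vecMulVec_mulVec, hf]; simp
  · rw [← sub_add_cancel N 1, hv, add_mulVec, vecMulVec_mulVec, hg]; simp

end Unipotent

theorem exists_conj_eq_phiStar {S D A : Matrix (Fin 3) (Fin 3) ℂ} (hD : IsUnit D.det)
    (hS : Dᵀ * phiStarForm * D = S) (hA : A.det = 1) (hAS : Aᵀ * S * A = S) :
    ∃ N : Matrix (Fin 2) (Fin 2) ℂ, N.det = 1 ∧ D * A * D⁻¹ = PhiStar N := by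
  apply exists_eq_phiStar
  · rw [det_conj ((isUnit_iff_isUnit_det D).mpr hD), hA]
  · have h1 : (D⁻¹)ᵀ * Dᵀ = 1 := by rw [← transpose_mul, mul_nonsing_inv _ hD, transpose_one]
    calc (D * A * D⁻¹)ᵀ * phiStarForm * (D * A * D⁻¹)
        = (D⁻¹)ᵀ * (Aᵀ * (Dᵀ * phiStarForm * D) * A) * D⁻¹ := by
          simp only [transpose_mul, mul_assoc]
      _ = (D⁻¹)ᵀ * Dᵀ * phiStarForm * (D * D⁻¹) := by
          rw [hS, hAS, ← hS]; simp only [mul_assoc]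
      _ = phiStarForm := by rw [h1, mul_nonsing_inv _ hD, one_mul, mul_one]

theorem reducible_or_conjugate_into_image_of_PhiStar
    (A B C : Matrix (Fin 3) (Fin 3) ℂ)
    (hA : A.det = 1) (hB : B.det = 1) (hC : C.det = 1)
    (h : C * B * A = 1)
    (hAtr : A.trace = (A⁻¹).trace)
    (hBtr : B.trace = (B⁻¹).trace)
    (hCtr : C.trace = (C⁻¹).trace)
    (hσ : (A⁻¹ * B).trace - (A⁻¹).trace * B.trace
        = (B⁻¹ * A).trace - (B⁻¹).trace * A.trace)
    (hcomm : (A * B * A⁻¹ * B⁻¹).trace = ((A * B * A⁻¹ * B⁻¹)⁻¹).trace) :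
    (∃ W : Submodule ℂ (Fin 3 → ℂ), W ≠ ⊥ ∧ W ≠ ⊤ ∧
      (∀ v ∈ W, A.mulVec v ∈ W) ∧ (∀ v ∈ W, B.mulVec v ∈ W)) ∨
    (∃ D : Matrix (Fin 3) (Fin 3) ℂ, IsUnit D ∧
      ∃ Ah Bh : Matrix (Fin 2) (Fin 2) ℂ, Ah.det = 1 ∧ Bh.det = 1 ∧
        D * A * D⁻¹ = PhiStar Ah ∧ D * B * D⁻¹ = PhiStar Bh) := by
  refine or_iff_not_imp_left.mpr fun hred ↦ ?_
  have hirr : ∀ W : Submodule ℂ (Fin 3 → ℂ), (∀ x ∈ W, A *ᵥ x ∈ W) → (∀ x ∈ W, B *ᵥ x ∈ W) →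
      W = ⊥ ∨ W = ⊤ := by
    intro W hWA hWB
    by_contra! hW
    exact hred ⟨W, hW.1, hW.2, hWA, hWB⟩
  have inv_eq : ∀ g : Matrix.SpecialLinearGroup (Fin 3) ℂ,
      (g : Matrix (Fin 3) (Fin 3) ℂ)⁻¹ = (g⁻¹ : Matrix.SpecialLinearGroup (Fin 3) ℂ) := fun g ↦ by
    rw [Matrix.SpecialLinearGroup.coe_inv, inv_def, g.2, Ring.inverse_one, one_smul]
  set a : Matrix.SpecialLinearGroup (Fin 3) ℂ := ⟨A, hA⟩
  set b : Matrix.SpecialLinearGroup (Fin 3) ℂ := ⟨B, hB⟩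
  have hCinv : C⁻¹ = B * A := inv_eq_right_inv (by rw [← mul_assoc, h])
  have hBAinv : (B * A)⁻¹ = C := inv_eq_left_inv (by rw [← mul_assoc, h])
  have htr : ∀ g ∈ Subgroup.closure {a, b}, (g : Matrix (Fin 3) (Fin 3) ℂ).trace
      = ((g⁻¹ : Matrix.SpecialLinearGroup (Fin 3) ℂ) : Matrix (Fin 3) (Fin 3) ℂ).trace := by
    intro g hg
    refine isCharacterLike_trace_eq_trace_inv.of_mem_closure (a := a) (b := b) ?_ ?_ ?_ ?_ ?_ hg
    · simp only [← inv_eq]; exact hAtr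
    · simp only [← inv_eq]; exact hBtr
    · simp only [← inv_eq, Matrix.SpecialLinearGroup.coe_mul]
      change (B * A).trace = ((B * A)⁻¹).trace
      rw [hBAinv, hCtr, hCinv]
    · rw [_root_.mul_inv_rev, inv_inv]
      simp only [← inv_eq, Matrix.SpecialLinearGroup.coe_mul]
      change (A⁻¹ * B).trace = (B⁻¹ * A).trace
      rw [← hAtr, ← hBtr] at hσ
      linear_combination hσ
    · simp only [← inv_eq, Matrix.SpecialLinearGroup.coe_mul]
      exact hcomm
  have haH : a ∈ Subgroup.closure {a, b} := Subgroup.subset_closure (by simp)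
  have hbH : b ∈ Subgroup.closure {a, b} := Subgroup.subset_closure (by simp)
  obtain ⟨c, hc, hc0⟩ : ∃ c ∈ Subgroup.closure {a, b},
      ((c : Matrix (Fin 3) (Fin 3) ℂ) - 1).adjugate ≠ 0 := by
    by_contra! hall
    obtain ⟨x, hx, hAx, hBx⟩ := exists_common_fixed_vector (hall a haH) (hall b hbH)
    have hfix : ∀ {M : Matrix (Fin 3) (Fin 3) ℂ}, M *ᵥ x = x →
        ∀ y ∈ Submodule.span ℂ {x}, M *ᵥ y ∈ Submodule.span ℂ {x} := by
      intro M hM y hy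
      obtain ⟨r, rfl⟩ := Submodule.mem_span_singleton.mp hy
      rwa [mulVec_smul, hM]
    rcases hirr _ (hfix hAx) (hfix hBx) with hW | hW
    · exact hx (Submodule.span_singleton_eq_bot.mp hW)
    · have := finrank_span_singleton (K := ℂ) hx
      rw [hW, finrank_top, Module.finrank_fin_fun] at this
      norm_num at this
  obtain ⟨v, f, hvf⟩ := exists_adjugate_sub_one_eq_vecMulVec c.2
    (by rw [← Matrix.SpecialLinearGroup.coe_inv]; exact htr c hc)
  have hv : v ≠ 0 := by rintro rfl; exact hc0 (by rw [hvf, zero_vecMulVec])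
  have hf : f ≠ 0 := by rintro rfl; exact hc0 (by rw [hvf, vecMulVec_zero])
  obtain ⟨S, hS0, hSs, hS⟩ := exists_invariant_symmetric_of_trace_eq_trace_inv
    (fun W hW ↦ hirr W (hW a haH) (hW b hbH)) htr hc hv hf
    (by rw [← hvf, Matrix.SpecialLinearGroup.coe_inv, ← adjugate_sub_one_fin_three])
  obtain ⟨D, hD⟩ := exists_transpose_mul_mul_eq (T := phiStarForm) hSs
    (by ext i j; fin_cases i <;> fin_cases j <;> rfl) hS0 (by simp [phiStarForm, det_fin_three])
  have hDu : IsUnit D.det := by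
    refine isUnit_iff_ne_zero.mpr fun h0 ↦ hS0 ?_
    rw [← hD, det_mul, h0, mul_zero]
  obtain ⟨Ah, hAh, hAh'⟩ := exists_conj_eq_phiStar hDu hD hA (hS a haH)
  obtain ⟨Bh, hBh, hBh'⟩ := exists_conj_eq_phiStar hDu hD hB (hS b hbH)
  exact ⟨D, (isUnit_iff_isUnit_det D).mpr hDu, Ah, Bh, hAh, hBh, hAh', hBh'⟩
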